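/- Let G be a connected decomposable claw-free graph with maximum degree 3 such that χ'_irr(G) > 3 and every decomposable claw-free graph with maximum degree at most 3 and fewer edges than G has locally irregular chromatic index at most 3. Then G contains no pendant 2-path; in particular, G has no edge uv with d(u) = 1 and d(v) = 2. -/

import Mathlib

/-- A graph is *locally irregular* if no two adjacent vertices have the same degree. -/
def LocallyIrregular {V : Type*} (G : SimpleGraph V) : Prop :=
  ∀ ⦃u v : V⦄, G.Adj u v → (G.neighborSet u).ncard ≠ (G.neighborSet v).ncard

/-- `HasLIEC G k` : `G` admits a locally irregular edge-coloring using at most `k` colors,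
i.e. an assignment of one of `k` colors to every edge such that the edges of each fixed
color induce a locally irregular graph. -/
def HasLIEC {V : Type*} (G : SimpleGraph V) (k : ℕ) : Prop :=
  ∃ c : Sym2 V → Fin k, ∀ i : Fin k,
    LocallyIrregular (SimpleGraph.fromEdgeSet {e | e ∈ G.edgeSet ∧ c e = i})

/-- A graph is *decomposable* if it admits a locally irregular edge-coloring. -/
def Decomposable {V : Type*} (G : SimpleGraph V) : Prop :=
  ∃ k : ℕ, HasLIEC G k

/-- A graph is *claw-free* if it contains no induced subgraph isomorphic to `K_{1,3}`. -/
def ClawFree {V : Type*} (G : SimpleGraph V) : Prop :=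
  ¬ ∃ v a b c : V, a ≠ b ∧ a ≠ c ∧ b ≠ c ∧
      G.Adj v a ∧ G.Adj v b ∧ G.Adj v c ∧ ¬ G.Adj a b ∧ ¬ G.Adj a c ∧ ¬ G.Adj b c

/-- `G` has maximum degree at most `d`. -/
def MaxDegreeLE {V : Type*} (G : SimpleGraph V) (d : ℕ) : Prop :=
  ∀ v : V, (G.neighborSet v).ncard ≤ d

def Good {V C : Type*} (G : SimpleGraph V) (c : Sym2 V → C) : Prop :=
  ∀ u v, G.Adj u v → {w | G.Adj u w ∧ c s(u,w) = c s(u,v)}.ncard ≠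
    {w | G.Adj v w ∧ c s(v,w) = c s(u,v)}.ncard

theorem hasLIEC_iff {V : Type*} (G : SimpleGraph V) (k : ℕ) :
    HasLIEC G k ↔ ∃ c : Sym2 V → Fin k, Good G c := by
  have key : ∀ (c : Sym2 V → Fin k) (i : Fin k) (u : V),
      (SimpleGraph.fromEdgeSet {e | e ∈ G.edgeSet ∧ c e = i}).neighborSet u =
      {w | G.Adj u w ∧ c s(u,w) = i} := by
    intro c i u
    ext w
    simp only [SimpleGraph.mem_neighborSet, SimpleGraph.fromEdgeSet_adj, Set.mem_ofPred_eq,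
      SimpleGraph.mem_edgeSet]
    constructor
    · exact fun h => h.1
    · exact fun h => ⟨h, h.1.ne⟩
  unfold HasLIEC LocallyIrregular
  refine exists_congr fun c => ?_
  simp only [key]
  constructor
  · intro h u v huv
    apply h (c s(u,v))
    simp [huv, huv.ne]
  · intro h i u v huv
    simp only [SimpleGraph.fromEdgeSet_adj, Set.mem_ofPred_eq, SimpleGraph.mem_edgeSet] at huv
    obtain ⟨⟨h1, h2⟩, h3⟩ := huv
    subst h2
    exact h u v h1

theorem Good.comp {V C D : Type*} {G : SimpleGraph V} {c : Sym2 V → C} (h : Good G c)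
    (d : Sym2 V → D) (hd : ∀ e f, d e = d f ↔ c e = c f) : Good G d := by
  intro u v huv
  simp only [hd]
  exact h u v huv

theorem dec_iff {V : Type*} [Finite V] (G : SimpleGraph V) :
    Decomposable G ↔ ∃ c : Sym2 V → ℕ, Good G c := by
  constructor
  · rintro ⟨k, hk⟩
    obtain ⟨c, hc⟩ := (hasLIEC_iff G k).1 hk
    exact ⟨fun e => (c e).val, hc.comp _ (fun e f => by simp [Fin.ext_iff])⟩
  · rintro ⟨c, hc⟩
    obtain ⟨M, hM⟩ := (Set.finite_range c).bddAbove
    refine ⟨M + 1, (hasLIEC_iff G _).2 ⟨fun e => ⟨c e, ?_⟩, hc.comp _ (fun e f => by simp)⟩⟩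
    exact Nat.lt_succ_of_le (hM ⟨e, rfl⟩)

/-- star with centre `y` and leaf set `S` -/
def starG {V : Type*} (y : V) (S : Set V) : SimpleGraph V where
  Adj a b := a ≠ b ∧ ((a = y ∧ b ∈ S) ∨ (b = y ∧ a ∈ S))
  symm := ⟨by intro a b h; exact ⟨h.1.symm, h.2.symm⟩⟩
  loopless := ⟨by intro a h; exact h.1 rfl⟩

theorem star_adj {V : Type*} (y : V) (S : Set V) (a b : V) :
    (starG y S).Adj a b ↔ a ≠ b ∧ ((a = y ∧ b ∈ S) ∨ (b = y ∧ a ∈ S)) := Iff.rfl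

theorem good_star {V C : Type*} [Finite V] (y : V) (S : Set V) (hy : y ∉ S)
    (p q : V) (hp : p ∈ S) (hq : q ∈ S) (hpq : p ≠ q) (i : C) :
    Good (starG y S) (fun _ => i) := by
  have h1 : {w | (starG y S).Adj y w} = S := by
    ext w; simp only [star_adj, Set.mem_ofPred_eq]; grind
  have h2 : ∀ x ∈ S, {w | (starG y S).Adj x w} = {y} := by
    intro x hx
    ext w; simp only [star_adj, Set.mem_ofPred_eq, Set.mem_singleton_iff]; grind
  have h3 : 1 < S.ncard := (Set.one_lt_ncard (Set.toFinite _)).2 ⟨p, hp, q, hq, hpq⟩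
  intro u v huv
  simp only [and_true]
  rcases huv.2 with ⟨rfl, h⟩ | ⟨rfl, h⟩
  · rw [h1, h2 v h, Set.ncard_singleton]; omega
  · rw [h1, h2 u h, Set.ncard_singleton]; omega

open Classical in
theorem good_glue {V C : Type*} (G K : SimpleGraph V) (hK : K ≤ G) (c d : Sym2 V → C)
    (hc : Good (G \ K) c) (hd : Good K d)
    (hcd : ∀ x y z, (G \ K).Adj x y → K.Adj x z → c s(x,y) ≠ d s(x,z)) :
    Good G (fun e => if e ∈ K.edgeSet then d e else c e) := by
  intro u v huv
  simp only [SimpleGraph.mem_edgeSet]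
  by_cases h : K.Adj u v
  · have h' := h.symm
    have e1 : ∀ u v, K.Adj u v → {w | G.Adj u w ∧ (if K.Adj u w then d s(u,w) else c s(u,w)) = d s(u,v)}
        = {w | K.Adj u w ∧ d s(u,w) = d s(u,v)} := by
      intro u v h
      ext w
      simp only [Set.mem_ofPred_eq]
      by_cases hw : K.Adj u w
      · simp [hw, hK hw]
      · simp only [hw, if_false, false_and, iff_false, not_and]
        intro hg
        exact hcd u w v ⟨hg, hw⟩ h
    rw [if_pos h, e1 u v h, Sym2.eq_swap, e1 v u h', Sym2.eq_swap]
    exact hd u v h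
  · have h' : (G \ K).Adj u v := ⟨huv, h⟩
    have e1 : ∀ u v, (G \ K).Adj u v → {w | G.Adj u w ∧ (if K.Adj u w then d s(u,w) else c s(u,w)) = c s(u,v)}
        = {w | (G \ K).Adj u w ∧ c s(u,w) = c s(u,v)} := by
      intro u v h
      ext w
      simp only [Set.mem_ofPred_eq, SimpleGraph.sdiff_adj]
      by_cases hw : K.Adj u w
      · simp only [hw, if_true, not_true, and_false, false_and, iff_false, not_and]
        intro hg
        exact (hcd u v w h hw).symm
      · simp [hw]
    rw [if_neg h, e1 u v h', Sym2.eq_swap, e1 v u h'.symm, Sym2.eq_swap]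
    exact hc u v h'

theorem good_restrict {V C : Type*} [Finite V] (G H : SimpleGraph V) (hH : H ≤ G) (c : Sym2 V → C)
    (hc : Good G c)
    (h : ∀ x y z, G.Adj x y → ¬ H.Adj x y → H.Adj x z → c s(x,y) = c s(x,z) →
      (∀ w, H.Adj x w → c s(x,w) = c s(x,z) → w = z) ∧
      (∃ w, w ≠ x ∧ H.Adj z w ∧ c s(z,w) = c s(x,z))) : Good H c := by
  have key : ∀ x z, H.Adj x z → (∃ y, G.Adj x y ∧ ¬ H.Adj x y ∧ c s(x,y) = c s(x,z)) →
      {w | H.Adj x w ∧ c s(x,w) = c s(x,z)}.ncard ≠ {w | H.Adj z w ∧ c s(z,w) = c s(x,z)}.ncard := by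
    rintro x z hxz ⟨y, h1, h2, h3⟩
    obtain ⟨h4, w, hw1, hw2, hw3⟩ := h x y z h1 h2 hxz h3
    have e1 : {w | H.Adj x w ∧ c s(x,w) = c s(x,z)} = {z} := by
      ext w
      simp only [Set.mem_ofPred_eq, Set.mem_singleton_iff]
      constructor
      · exact fun h => h4 w h.1 h.2
      · rintro rfl; exact ⟨hxz, rfl⟩
    have e2 : 1 < {w | H.Adj z w ∧ c s(z,w) = c s(x,z)}.ncard :=
      (Set.one_lt_ncard (Set.toFinite _)).2 ⟨w, ⟨hw2, hw3⟩, x, ⟨hxz.symm, by rw [Sym2.eq_swap]⟩, hw1⟩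
    rw [e1, Set.ncard_singleton]; omega
  have same : ∀ x z, (¬ ∃ y, G.Adj x y ∧ ¬ H.Adj x y ∧ c s(x,y) = c s(x,z)) →
      {w | H.Adj x w ∧ c s(x,w) = c s(x,z)} = {w | G.Adj x w ∧ c s(x,w) = c s(x,z)} := by
    intro x z hn
    ext w
    simp only [Set.mem_ofPred_eq]
    constructor
    · exact fun h => ⟨hH h.1, h.2⟩
    · rintro ⟨h1, h2⟩
      refine ⟨?_, h2⟩
      by_contra h3
      exact hn ⟨w, h1, h3, h2⟩
  intro u v huv
  by_cases hu : ∃ y, G.Adj u y ∧ ¬ H.Adj u y ∧ c s(u,y) = c s(u,v)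
  · exact key u v huv hu
  by_cases hv : ∃ y, G.Adj v y ∧ ¬ H.Adj v y ∧ c s(v,y) = c s(v,u)
  · have := key v u huv.symm hv
    rw [Sym2.eq_swap (a := u)]
    exact this.symm
  have := hc u v (hH huv)
  rw [same u v hu]
  have s2 := same v u hv
  rw [Sym2.eq_swap (a := v) (b := u)] at s2
  rw [s2]
  exact this

def Dec {V : Type*} (G : SimpleGraph V) : Prop := ∃ c : Sym2 V → ℕ, Good G c

theorem dec_star {V : Type*} [Finite V] (G : SimpleGraph V) (y : V) (S : Set V)
    (hS : ∀ x ∈ S, G.Adj y x)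
    (p q : V) (hp : p ∈ S) (hq : q ∈ S) (hpq : p ≠ q) (h : Dec (G \ starG y S)) : Dec G := by
  obtain ⟨c, hc⟩ := h
  obtain ⟨M, hM⟩ := (Set.finite_range c).bddAbove
  refine ⟨_, good_glue G (starG y S) ?_ c (fun _ => M+1) hc
    (good_star y S (fun h => (hS y h).ne rfl) p q hp hq hpq (M+1)) ?_⟩
  · intro a b hab
    rcases hab.2 with ⟨rfl, h⟩ | ⟨rfl, h⟩
    · exact hS _ h
    · exact (hS _ h).symm
  · intro x y z _ _ h
    have := hM ⟨s(x,y), rfl⟩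
    omega

theorem nbr3 {V : Type*} [Finite V] (G : SimpleGraph V) (hdeg : MaxDegreeLE G 3) {x p q r : V}
    (hp : G.Adj x p) (hq : G.Adj x q) (hr : G.Adj x r) (h1 : p ≠ q) (h2 : p ≠ r) (h3 : q ≠ r) :
    ∀ t, G.Adj x t → t = p ∨ t = q ∨ t = r := by
  intro t ht
  by_contra hn
  push Not at hn
  obtain ⟨n1, n2, n3⟩ := hn
  have hsub : ({t, p, q, r} : Set V) ⊆ G.neighborSet x := by
    intro y hy
    simp only [Set.mem_insert_iff, Set.mem_singleton_iff] at hy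
    rcases hy with rfl | rfl | rfl | rfl <;> assumption
  have := Set.ncard_le_ncard hsub (Set.toFinite _)
  rw [Set.ncard_insert_of_notMem (by simp [*]), Set.ncard_insert_of_notMem (by simp [*]),
    Set.ncard_pair h3] at this
  have := hdeg x
  omega

theorem good_comap {V W C : Type*} (e : W ≃ V) (G : SimpleGraph V) (c : Sym2 V → C)
    (h : Good G c) : Good (G.comap e) (fun x => c (x.map e)) := by
  intro u v huv
  have := h (e u) (e v) huv
  have k : ∀ (x : V → Prop), {w | x (e w)}.ncard = {w | x w}.ncard := by
    intro x
    exact Set.ncard_preimage_of_injective_subset_range (s := {w | x w}) e.injective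
      (by rw [e.surjective.range_eq]; exact Set.subset_univ _)
  simp only [SimpleGraph.comap_adj, Sym2.map_mk]
  rw [k (fun w => G.Adj (e u) w ∧ c s(e u, w) = c s(e u, e v)),
    k (fun w => G.Adj (e v) w ∧ c s(e v, w) = c s(e u, e v))]
  exact this

theorem transport {V : Type*} [Fintype V] (n : ℕ)
    (hmin : ∀ (W : Type) [Fintype W] (H : SimpleGraph W),
      Decomposable H → ClawFree H → MaxDegreeLE H 3 →
      H.edgeSet.ncard < n → HasLIEC H 3)
    (G : SimpleGraph V) (h1 : Decomposable G) (h2 : ClawFree G) (h3 : MaxDegreeLE G 3)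
    (h4 : G.edgeSet.ncard < n) : HasLIEC G 3 := by
  let e : Fin (Fintype.card V) ≃ V := (Fintype.equivFin V).symm
  have := hmin (Fin (Fintype.card V)) (G.comap e) ?_ ?_ ?_ ?_
  · rw [hasLIEC_iff] at this ⊢
    obtain ⟨c, hc⟩ := this
    have := good_comap e.symm _ _ hc
    have hh : (G.comap e).comap e.symm = G := by ext a b; simp
    rw [hh] at this
    exact ⟨_, this⟩
  · rw [dec_iff] at h1 ⊢
    obtain ⟨c, hc⟩ := h1
    exact ⟨_, good_comap e _ _ hc⟩
  · rintro ⟨v, a, b, c, n1, n2, n3, h⟩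
    exact h2 ⟨e v, e a, e b, e c, e.injective.ne n1, e.injective.ne n2, e.injective.ne n3, h⟩
  · intro v
    refine le_trans (Set.ncard_le_ncard_of_injOn (t := G.neighborSet (e v)) e ?_ e.injective.injOn
      (Set.toFinite _)) (h3 (e v))
    intro a ha; exact ha
  · refine lt_of_le_of_lt (Set.ncard_le_ncard_of_injOn (t := G.edgeSet) (Sym2.map e) ?_
      (Sym2.map.injective e.injective).injOn (Set.toFinite _)) h4
    intro a
    induction a using Sym2.ind
    exact fun h => h

theorem dec_case {V : Type*} [Finite V] (G : SimpleGraph V) (hdeg : MaxDegreeLE G 3)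
    (c : Sym2 V → ℕ) (hc : Good G c) (u v w a b a' : V)
    (huv : G.Adj u v) (hvw : G.Adj v w) (hwa : G.Adj w a) (hwb : G.Adj w b) (hab : G.Adj a b)
    (haa : G.Adj a a')
    (nu : ∀ t, G.Adj u t → t = v) (nv : ∀ t, G.Adj v t → t = u ∨ t = w)
    (nw : ∀ t, G.Adj w t → t = v ∨ t = a ∨ t = b)
    (hav : a ≠ v) (hbv : b ≠ v) (huw : u ≠ w) (hba : a' ≠ b)
    (c1 : c s(u,v) = c s(w,a)) (c2 : c s(v,w) = c s(w,a)) (c3 : c s(w,b) = c s(w,a))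
    (c4 : c s(a,b) ≠ c s(w,a)) (c5 : c s(a,a') = c s(a,b))
    (c6 : ∀ t, G.Adj b t → t ≠ a → c s(b,t) ≠ c s(a,b)) :
    Dec (G \ starG v {u, w}) := by
  have hne : ∀ x y, G.Adj x y → x ≠ y := fun x y h => h.ne
  have sym : ∀ x y, G.Adj x y → G.Adj y x := fun x y h => h.symm
  have cs0 : ∀ x y, c s(x,y) = c s(y,x) := fun x y => by rw [Sym2.eq_swap]
  obtain ⟨f, hf⟩ : ∃ f : V → V → ℕ, ∀ x y, c s(x,y) = f x y := ⟨_, fun _ _ => rfl⟩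
  have cs : ∀ x y, f x y = f y x := fun x y => by rw [← hf, ← hf]; exact cs0 x y
  clear cs0
  simp only [hf] at c1 c2 c3 c4 c5 c6
  have haw : a' ≠ w := by rintro rfl; rw [cs] at c5; exact c4 c5.symm
  have na := nbr3 G hdeg hwa.symm hab haa hwb.ne haw.symm hba.symm
  have n1 : a ≠ u := by rintro rfl; exact hvw.ne (nu _ hwa.symm).symm
  have n2 : b ≠ u := by rintro rfl; exact hvw.ne (nu _ hwb.symm).symm
  have A1 : Dec ((G \ starG v {u, w}) \ starG w {a, b}) → Dec (G \ starG v {u, w}) := by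
    apply dec_star (p := a) (q := b)
    · simp only [hf, SimpleGraph.sdiff_adj, star_adj, Set.mem_insert_iff, Set.mem_singleton_iff]
      have := hvw.ne
      (clear hf hc; grind)
    · simp
    · simp
    · exact hab.ne
  by_cases hb : ∃ b', G.Adj b b' ∧ b' ≠ w ∧ f b b' = f w a
  swap
  · apply A1
    refine ⟨c, good_restrict G _ (sdiff_le.trans sdiff_le) c hc ?_⟩
    simp only [hf, SimpleGraph.sdiff_adj, star_adj, Set.mem_insert_iff, Set.mem_singleton_iff]
    intro x y z hxy hn hxz e
    exfalso
    (clear hf hc; grind)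
  obtain ⟨b', hb1, hb2, hb3⟩ := hb
  have hb4 : b' ≠ a := by rintro rfl; rw [cs] at hb3; exact c4 hb3
  have nb := nbr3 G hdeg hwb.symm hab.symm hb1 hwa.ne hb2.symm hb4.symm
  have hb5 : b' ≠ v := by rintro rfl; have := nv _ hb1.symm; have := hwb.ne; (clear hf hc; grind)
  have hb6 : b' ≠ u := by rintro rfl; have := nu _ hb1.symm; (clear hf hc; grind)
  by_cases hz : ∃ z, z ≠ b ∧ G.Adj b' z ∧ f b' z = f w a
  · obtain ⟨z, hz1, hz2, hz3⟩ := hz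
    apply A1
    refine ⟨c, good_restrict G _ (sdiff_le.trans sdiff_le) c hc ?_⟩
    simp only [hf, SimpleGraph.sdiff_adj, star_adj, Set.mem_insert_iff, Set.mem_singleton_iff]
    intro x y z' hxy hn hxz e
    have hx : x = b ∧ z' = b' := by (clear hf hc; grind)
    obtain ⟨rfl, rfl⟩ := hx
    constructor
    · (clear hf hc; grind)
    · refine ⟨z, hz1, ?_, ?_⟩ <;> (clear hf hc; grind)
  push Not at hz
  have hwb' := hwb.ne
  have hwa' := hwa.ne
  have hab' := hab.ne
  have ha5 : a' ≠ v := by rintro rfl; have := nv _ haa.symm; (clear hf hc; grind)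
  have ha6 : a' ≠ u := by rintro rfl; have := nu _ haa.symm; (clear hf hc; grind)
  have hvw' := hvw.ne
  have hbb' := hb1.ne
  have haa' := haa.ne
  apply dec_star _ b {b', w} (p := b') (q := w)
  · simp only [hf, SimpleGraph.sdiff_adj, star_adj, Set.mem_insert_iff, Set.mem_singleton_iff]
    (clear hf hc; grind)
  · simp
  · simp
  · exact hb2
  by_cases hy : ∃ y, y ≠ a ∧ G.Adj a' y ∧ f a' y = f a b
  · obtain ⟨y, hy1, hy2, hy3⟩ := hy
    apply dec_star _ a {b, w} (p := b) (q := w)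
    · simp only [hf, SimpleGraph.sdiff_adj, star_adj, Set.mem_insert_iff, Set.mem_singleton_iff]
      (clear hf hc; grind)
    · simp
    · simp
    · exact hwb.ne.symm
    refine ⟨c, good_restrict G _ (sdiff_le.trans (sdiff_le.trans sdiff_le)) c hc ?_⟩
    simp only [hf, SimpleGraph.sdiff_adj, star_adj, Set.mem_insert_iff, Set.mem_singleton_iff]
    intro x y' z' hxy hn hxz e
    have hx : x = a ∧ z' = a' := by (clear hf hc; grind)
    obtain ⟨rfl, rfl⟩ := hx
    constructor
    · (clear hf hc; grind)
    · refine ⟨y, hy1, ?_, ?_⟩ <;> (clear hf hc; grind)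
  · push Not at hy
    apply dec_star _ a {a', b, w} (p := b) (q := w)
    · simp only [hf, SimpleGraph.sdiff_adj, star_adj, Set.mem_insert_iff, Set.mem_singleton_iff]
      (clear hf hc; grind)
    · simp
    · simp
    · exact hwb.ne.symm
    refine ⟨c, good_restrict G _ (sdiff_le.trans (sdiff_le.trans sdiff_le)) c hc ?_⟩
    simp only [hf, SimpleGraph.sdiff_adj, star_adj, Set.mem_insert_iff, Set.mem_singleton_iff]
    intro x y' z' hxy hn hxz e
    exfalso
    (clear hf hc; grind)

theorem dec_sub {V : Type*} [Finite V] (G : SimpleGraph V) (hdeg : MaxDegreeLE G 3)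
    (hclaw : ClawFree G)
    (c : Sym2 V → ℕ) (hc : Good G c) (u v w : V)
    (huv : G.Adj u v) (hvw : G.Adj v w) (huw : u ≠ w)
    (nu : ∀ t, G.Adj u t → t = v) (nv : ∀ t, G.Adj v t → t = u ∨ t = w) :
    Dec (G \ starG v {u, w}) := by
  have hne : ∀ x y, G.Adj x y → x ≠ y := fun x y h => h.ne
  have sym : ∀ x y, G.Adj x y → G.Adj y x := fun x y h => h.symm
  have cs : ∀ x y, c s(x,y) = c s(y,x) := fun x y => by rw [Sym2.eq_swap]
  have e1 : {t | G.Adj u t ∧ c s(u,t) = c s(u,v)} = {v} := by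
    ext t; simp only [Set.mem_ofPred_eq, Set.mem_singleton_iff]; grind
  have c1 : c s(v,w) = c s(u,v) := by
    by_contra hn
    apply hc u v huv
    have e2 : {t | G.Adj v t ∧ c s(v,t) = c s(u,v)} = {u} := by
      ext t; simp only [Set.mem_ofPred_eq, Set.mem_singleton_iff]; grind
    rw [e1, e2, Set.ncard_singleton, Set.ncard_singleton]
  by_cases ha : ∃ a, G.Adj w a ∧ a ≠ v ∧ c s(w,a) = c s(u,v)
  swap
  · refine ⟨c, good_restrict G _ sdiff_le c hc ?_⟩
    simp only [SimpleGraph.sdiff_adj, star_adj, Set.mem_insert_iff, Set.mem_singleton_iff]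
    intro x y z hxy hn hxz e
    exfalso
    grind
  obtain ⟨a, hwa, hav, ca⟩ := ha
  have hb : ∃ b, G.Adj w b ∧ b ≠ v ∧ b ≠ a ∧ c s(w,b) = c s(u,v) := by
    by_contra hn
    push Not at hn
    apply hc v w hvw
    have e2 : {t | G.Adj v t ∧ c s(v,t) = c s(v,w)} = {u, w} := by
      ext t; simp only [Set.mem_ofPred_eq, Set.mem_singleton_iff, Set.mem_insert_iff]; grind
    have e3 : {t | G.Adj w t ∧ c s(w,t) = c s(v,w)} = {v, a} := by
      ext t; simp only [Set.mem_ofPred_eq, Set.mem_singleton_iff, Set.mem_insert_iff]; grind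
    rw [e2, e3, Set.ncard_pair huw, Set.ncard_pair hav.symm]
  obtain ⟨b, hwb, hbv, hba, cb⟩ := hb
  have nw := nbr3 G hdeg hvw.symm hwa hwb hav.symm hbv.symm hba.symm
  have n1 : a ≠ u := by rintro rfl; exact hvw.ne (nu _ hwa.symm).symm
  have n2 : b ≠ u := by rintro rfl; exact hvw.ne (nu _ hwb.symm).symm
  have hab : G.Adj a b := by
    by_contra hn
    apply hclaw
    refine ⟨w, v, a, b, hav.symm, hbv.symm, hba.symm, hvw.symm, hwa, hwb, ?_, ?_, hn⟩ <;> grind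
  have hwa' := hwa.ne
  have hwb' := hwb.ne
  have c4 : c s(a,b) ≠ c s(w,a) := by
    intro h
    by_cases hA : ∃ x, G.Adj a x ∧ x ≠ w ∧ x ≠ b ∧ c s(a,x) = c s(w,a)
    · obtain ⟨x, hx1, hx2, hx3, hx4⟩ := hA
      have na := nbr3 G hdeg hwa.symm hab hx1 hwb' hx2.symm hx3.symm
      apply hc w a hwa
      have e2 : {t | G.Adj w t ∧ c s(w,t) = c s(w,a)} = {v, a, b} := by
        ext t; simp only [Set.mem_ofPred_eq, Set.mem_singleton_iff, Set.mem_insert_iff]; grind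
      have e3 : {t | G.Adj a t ∧ c s(a,t) = c s(w,a)} = {w, b, x} := by
        ext t; simp only [Set.mem_ofPred_eq, Set.mem_singleton_iff, Set.mem_insert_iff]; grind
      rw [e2, e3, Set.ncard_eq_three.2 ⟨v, a, b, hav.symm, hbv.symm, hba.symm, rfl⟩,
        Set.ncard_eq_three.2 ⟨w, b, x, hwb', hx2.symm, hx3.symm, rfl⟩]
    by_cases hB : ∃ x, G.Adj b x ∧ x ≠ w ∧ x ≠ a ∧ c s(b,x) = c s(w,a)
    · obtain ⟨x, hx1, hx2, hx3, hx4⟩ := hB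
      have nb := nbr3 G hdeg hwb.symm hab.symm hx1 hwa' hx2.symm hx3.symm
      apply hc w b hwb
      have e2 : {t | G.Adj w t ∧ c s(w,t) = c s(w,b)} = {v, a, b} := by
        ext t; simp only [Set.mem_ofPred_eq, Set.mem_singleton_iff, Set.mem_insert_iff]; grind
      have e3 : {t | G.Adj b t ∧ c s(b,t) = c s(w,b)} = {w, a, x} := by
        ext t; simp only [Set.mem_ofPred_eq, Set.mem_singleton_iff, Set.mem_insert_iff]; grind
      rw [e2, e3, Set.ncard_eq_three.2 ⟨v, a, b, hav.symm, hbv.symm, hba.symm, rfl⟩,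
        Set.ncard_eq_three.2 ⟨w, a, x, hwa', hx2.symm, hx3.symm, rfl⟩]
    push Not at hA hB
    apply hc a b hab
    have e2 : {t | G.Adj a t ∧ c s(a,t) = c s(a,b)} = {w, b} := by
      ext t; simp only [Set.mem_ofPred_eq, Set.mem_singleton_iff, Set.mem_insert_iff]; grind
    have e3 : {t | G.Adj b t ∧ c s(b,t) = c s(a,b)} = {w, a} := by
      ext t; simp only [Set.mem_ofPred_eq, Set.mem_singleton_iff, Set.mem_insert_iff]; grind
    rw [e2, e3, Set.ncard_pair hwb', Set.ncard_pair hwa']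
  by_cases hA : ∃ x, G.Adj a x ∧ x ≠ b ∧ c s(a,x) = c s(a,b)
  · obtain ⟨x, hx1, hx2, hx3⟩ := hA
    by_cases hB : ∃ y, G.Adj b y ∧ y ≠ a ∧ c s(b,y) = c s(a,b)
    · obtain ⟨y, hy1, hy2, hy3⟩ := hB
      exfalso
      have hxw : x ≠ w := by grind
      have hyw : y ≠ w := by grind
      have na := nbr3 G hdeg hwa.symm hab hx1 hwb' hxw.symm hx2.symm
      have nb := nbr3 G hdeg hwb.symm hab.symm hy1 hwa' hyw.symm hy2.symm
      apply hc a b hab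
      have e2 : {t | G.Adj a t ∧ c s(a,t) = c s(a,b)} = {b, x} := by
        ext t; simp only [Set.mem_ofPred_eq, Set.mem_singleton_iff, Set.mem_insert_iff]; grind
      have e3 : {t | G.Adj b t ∧ c s(b,t) = c s(a,b)} = {a, y} := by
        ext t; simp only [Set.mem_ofPred_eq, Set.mem_singleton_iff, Set.mem_insert_iff]; grind
      rw [e2, e3, Set.ncard_pair hx2.symm, Set.ncard_pair hy2.symm]
    · push Not at hB
      exact dec_case G hdeg c hc u v w a b x huv hvw hwa hwb hab hx1 nu nv nw hav hbv huw hx2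
        ca.symm (c1.trans ca.symm) (cb.trans ca.symm) c4 hx3 hB
  · push Not at hA
    by_cases hB : ∃ y, G.Adj b y ∧ y ≠ a ∧ c s(b,y) = c s(a,b)
    · obtain ⟨y, hy1, hy2, hy3⟩ := hB
      refine dec_case G hdeg c hc u v w b a y huv hvw hwb hwa hab.symm hy1 nu nv ?_ hbv hav huw hy2
        cb.symm (c1.trans cb.symm) (ca.trans cb.symm) ?_ ?_ ?_ <;> grind
    · push Not at hB
      exfalso
      apply hc a b hab
      have e2 : {t | G.Adj a t ∧ c s(a,t) = c s(a,b)} = {b} := by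
        ext t; simp only [Set.mem_ofPred_eq, Set.mem_singleton_iff]; grind
      have e3 : {t | G.Adj b t ∧ c s(b,t) = c s(a,b)} = {a} := by
        ext t; simp only [Set.mem_ofPred_eq, Set.mem_singleton_iff]; grind
      rw [e2, e3, Set.ncard_singleton, Set.ncard_singleton]

theorem minimal_cex_no_pendant_two_path {V : Type*} [Fintype V] (G : SimpleGraph V)
    (hconn : G.Connected) (hdec : Decomposable G) (hclaw : ClawFree G)
    (hdeg : MaxDegreeLE G 3) (hG : ¬ HasLIEC G 3)
    (hmin : ∀ (W : Type) [Fintype W] (H : SimpleGraph W),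
      Decomposable H → ClawFree H → MaxDegreeLE H 3 →
      H.edgeSet.ncard < G.edgeSet.ncard → HasLIEC H 3) :
    ¬ ∃ u v : V, G.Adj u v ∧ (G.neighborSet u).ncard = 1 ∧ (G.neighborSet v).ncard = 2 := by
  rintro ⟨u, v, huv, hu, hv⟩
  have hne : ∀ x y, G.Adj x y → x ≠ y := fun x y h => h.ne
  have sym : ∀ x y, G.Adj x y → G.Adj y x := fun x y h => h.symm
  have nu : ∀ t, G.Adj u t → t = v := by
    obtain ⟨s, hs⟩ := Set.ncard_eq_one.1 hu
    have k : ∀ t, G.Adj u t ↔ t = s := fun t => by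
      rw [← SimpleGraph.mem_neighborSet, hs, Set.mem_singleton_iff]
    grind
  obtain ⟨w, hvw, huw, nv⟩ : ∃ w, G.Adj v w ∧ u ≠ w ∧ ∀ t, G.Adj v t → t = u ∨ t = w := by
    obtain ⟨s, r, hsr, hs⟩ := Set.ncard_eq_two.1 hv
    have k : ∀ t, G.Adj v t ↔ t = s ∨ t = r := fun t => by
      rw [← SimpleGraph.mem_neighborSet, hs, Set.mem_insert_iff, Set.mem_singleton_iff]
    rcases (k u).1 huv.symm with rfl | rfl
    · exact ⟨r, (k r).2 (Or.inr rfl), hsr, fun t ht => (k t).1 ht⟩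
    · exact ⟨s, (k s).2 (Or.inl rfl), hsr.symm, fun t ht => ((k t).1 ht).symm⟩
  obtain ⟨c, hc⟩ := (dec_iff G).1 hdec
  have hD := (dec_iff _).2 (dec_sub G hdeg hclaw c hc u v w huv hvw huw nu nv)
  have hK : starG v {u, w} ≤ G := by
    intro a b hab
    simp only [star_adj, Set.mem_insert_iff, Set.mem_singleton_iff] at hab
    grind
  have hadj : ∀ x y, (G \ starG v {u, w}).Adj x y ↔ G.Adj x y ∧ x ≠ v ∧ y ≠ v := by
    intro x y
    simp only [SimpleGraph.sdiff_adj, star_adj, Set.mem_insert_iff, Set.mem_singleton_iff]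
    grind
  have h3 := transport G.edgeSet.ncard hmin _ hD ?_ ?_ ?_
  · obtain ⟨d, hd⟩ := (hasLIEC_iff _ _).1 h3
    obtain ⟨i, hi⟩ : ∃ i : Fin 3, ∀ y, (G \ starG v {u, w}).Adj w y → d s(w,y) ≠ i := by
      by_contra hn
      push Not at hn
      choose f hf1 hf2 using hn
      have hinj : ∀ i j, f i = f j → i = j := fun i j h => by rw [← hf2 i, ← hf2 j, h]
      have k := fun i => (hadj _ _).1 (hf1 i)
      have := nbr3 G hdeg (k 0).1 (k 1).1 (k 2).1 (fun h => absurd (hinj _ _ h) (by decide))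
        (fun h => absurd (hinj _ _ h) (by decide)) (fun h => absurd (hinj _ _ h) (by decide))
        v hvw.symm
      rcases this with h | h | h
      · exact (k 0).2.2 h.symm
      · exact (k 1).2.2 h.symm
      · exact (k 2).2.2 h.symm
    apply hG
    rw [hasLIEC_iff]
    refine ⟨_, good_glue G (starG v {u, w}) hK d (fun _ => i) hd
      (good_star v _ ?_ u w ?_ ?_ huw i) ?_⟩
    · simp [huv.ne.symm, hvw.ne]
    · simp
    · simp
    · intro x y z h1 h2
      have h4 := (hadj _ _).1 h1
      simp only [star_adj, Set.mem_insert_iff, Set.mem_singleton_iff] at h2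
      have : x = w := by grind
      subst this
      exact hi y h1
  · rintro ⟨x, p, q, r, n1, n2, n3, h1, h2, h3, h4, h5, h6⟩
    simp only [hadj] at h1 h2 h3 h4 h5 h6
    apply hclaw
    refine ⟨x, p, q, r, n1, n2, n3, h1.1, h2.1, h3.1, ?_, ?_, ?_⟩ <;> grind
  · intro x
    exact le_trans (Set.ncard_le_ncard (fun t ht => ((hadj _ _).1 ht).1) (Set.toFinite _)) (hdeg x)
  · apply Set.ncard_lt_ncard _ (Set.toFinite _)
    refine ⟨SimpleGraph.edgeSet_mono sdiff_le, fun h => ?_⟩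
    have := h (show s(u,v) ∈ G.edgeSet from huv)
    exact ((hadj _ _).1 this).2.2 rfl
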